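/- Let C = C_{t₁} ⊕ C_{t₂} be a quasi-cyclic code of length lm and index l over F_q, where 0 ≤ t₁ < t₂ ≤ s, each C_{t_j} (j = 1, 2) is a linear code over R_m ε_{t_j} of length l which, as an F_q-code, is an [lm, K_{t_j}] quasi-cyclic code, and the primitive idempotent ε_{t_j} corresponds to the q-cyclotomic coset {i_{t_j}, i_{t_j}q, …, i_{t_j}q^{k_{t_j}−1}} modulo m. Then the number of orbits of ⟨ρ^l⟩ on C* = C \ {0} is equal to gcd(m, i_{t₁}, i_{t₂})·(q^{K_{t₁}} − 1)(q^{K_{t₂}} − 1)/m + gcd(m, i_{t₁})·(q^{K_{t₁}} − 1)/m + gcd(m, i_{t₂})·(q^{K_{t₂}} − 1)/m. -/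

import Mathlib

/-- The shift `ρ^l` on `F^{lm}`, with a codeword indexed as `c (i, j) = c_{ij}`
(`i ∈ ZMod m` the block index, `j ∈ Fin l` the position inside a block):
`(ρ^l c) (i, j) = c (i - 1, j)`. -/
noncomputable def shiftQC (F : Type*) [Field F] (m l : ℕ) :
    ((ZMod m × Fin l) → F) ≃ₗ[F] ((ZMod m × Fin l) → F) :=
  LinearEquiv.funCongrLeft F F ((Equiv.subRight (1 : ZMod m)).prodCongr (Equiv.refl (Fin l)))

/-- The `q`-cyclotomic coset of `i_t` modulo `m`, viewed inside `ZMod m`. -/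
def cycCoset (q m it : ℕ) : Set (ZMod m) :=
  {j | ∃ r : ℕ, j = (it : ZMod m) * (q : ZMod m) ^ r}

/-- Evaluation of the polynomial `Σ_i c_i x^i ∈ R_m = F[x]/(x^m - 1)` at `ζ^j`, computed in
an extension field `E` of `F` containing the primitive `m`-th root of unity `ζ`. -/
noncomputable def evalDFT {F E : Type*} [Field F] [Field E] [Algebra F E] {m : ℕ} [NeZero m]
    (ζ : E) (c : ZMod m → F) (j : ZMod m) : E :=
  ∑ i : ZMod m, algebraMap F E (c i) * ζ ^ (i * j).val

/-- `Σ_i c_i x^i` lies in the minimal ideal `R_m ε_t` of `R_m` associated with the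
`q`-cyclotomic coset of `i_t`, i.e. it vanishes at `ζ^j` for every `j` outside the coset. -/
def inMinIdeal {F E : Type*} [Field F] [Field E] [Algebra F E] (q : ℕ) {m : ℕ} [NeZero m]
    (ζ : E) (it : ℕ) (c : ZMod m → F) : Prop :=
  ∀ j : ZMod m, j ∉ cycCoset q m it → evalDFT ζ c j = 0

section Orbits

variable {F E : Type*} [Field F] [Field E] [Algebra F E] {m l : ℕ}

theorem shiftQC_apply (c : (ZMod m × Fin l) → F) (i : ZMod m) (v : Fin l) :
    shiftQC F m l c (i, v) = c (i - 1, v) := rfl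

theorem IsPrimitiveRoot.pow_val_add [NeZero m] {ζ : E} (hζ : IsPrimitiveRoot ζ m)
    (a b : ZMod m) : ζ ^ (a + b).val = ζ ^ a.val * ζ ^ b.val := by
  rw [ZMod.val_add, ← pow_add, pow_eq_pow_mod (a.val + b.val) hζ.pow_eq_one]

/-- A word all of whose Fourier coefficients vanish is zero. -/
theorem eq_zero_of_evalDFT_eq_zero [NeZero m] {ζ : E} (hζ : IsPrimitiveRoot ζ m)
    (c : ZMod m → F) (hc : ∀ j, evalDFT ζ c j = 0) : c = 0 := by
  let χ : ZMod m → (Multiplicative (ZMod m) →* E) := fun i =>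
    { toFun := fun j => ζ ^ (i * j.toAdd).val
      map_one' := by simp
      map_mul' := fun a b => by
        rw [toAdd_mul, mul_add, hζ.pow_val_add] }
  have hχ : Function.Injective χ := by
    intro a b hab
    have h := DFunLike.congr_fun hab (Multiplicative.ofAdd 1)
    have h' : ζ ^ a.val = ζ ^ b.val := by simpa [χ] using h
    exact ZMod.val_injective m (hζ.pow_inj a.val_lt b.val_lt h')
  have hli := (linearIndependent_monoidHom (Multiplicative (ZMod m)) E).comp χ hχ
  rw [Fintype.linearIndependent_iff] at hli
  funext i
  have := hli (fun i => algebraMap F E (c i)) (by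
    funext j
    simpa [evalDFT, χ, Finset.sum_apply, -algebraMap_smul] using hc j.toAdd) i
  simpa using this

theorem evalDFT_sub [NeZero m] (ζ : E) (c d : ZMod m → F) (j : ZMod m) :
    evalDFT ζ (fun i => c i - d i) j = evalDFT ζ c j - evalDFT ζ d j := by
  simp [evalDFT, sub_mul, Finset.sum_sub_distrib]

theorem evalDFT_shiftQC [NeZero m] {ζ : E} (hζ : IsPrimitiveRoot ζ m)
    (c : (ZMod m × Fin l) → F) (v : Fin l) (j : ZMod m) :
    evalDFT ζ (fun i => shiftQC F m l c (i, v)) j =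
      ζ ^ j.val * evalDFT ζ (fun i => c (i, v)) j := by
  unfold evalDFT
  rw [Finset.mul_sum, ← Equiv.sum_comp (Equiv.addRight (1 : ZMod m))]
  refine Finset.sum_congr rfl fun i _ => ?_
  simp only [shiftQC_apply, Equiv.coe_addRight, add_sub_cancel_right, add_mul, one_mul,
    hζ.pow_val_add]
  ring

theorem evalDFT_shiftQC_pow [NeZero m] {ζ : E} (hζ : IsPrimitiveRoot ζ m) (n : ℕ)
    (c : (ZMod m × Fin l) → F) (v : Fin l) (j : ZMod m) :
    evalDFT ζ (fun i => (shiftQC F m l ^ n) c (i, v)) j =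
      (ζ ^ j.val) ^ n * evalDFT ζ (fun i => c (i, v)) j := by
  induction n with
  | zero => simp
  | succ n ih =>
    rw [pow_succ' (shiftQC F m l)]
    simp only [LinearEquiv.mul_apply]
    rw [evalDFT_shiftQC hζ, ih]
    ring

/-- A word is fixed by the `n`-th power of the shift iff `ζ ^ (n j) = 1` on its spectrum. -/
theorem shiftQC_pow_apply_eq_iff [NeZero m] {ζ : E} (hζ : IsPrimitiveRoot ζ m) (n : ℕ)
    (c : (ZMod m × Fin l) → F) :
    (shiftQC F m l ^ n) c = c ↔
      ∀ j v, evalDFT ζ (fun i => c (i, v)) j ≠ 0 → (n : ZMod m) * j = 0 := by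
  have key : ∀ j : ZMod m, (ζ ^ j.val) ^ n = 1 ↔ (n : ZMod m) * j = 0 := by
    intro j
    rw [← pow_mul, hζ.pow_eq_one_iff_dvd, ← ZMod.natCast_eq_zero_iff]
    simp [mul_comm]
  constructor
  · intro h j v hne
    have h1 := evalDFT_shiftQC_pow hζ n c v j
    rw [h] at h1
    exact (key j).1 (mul_right_cancel₀ hne (by rw [one_mul]; exact h1.symm))
  · intro h
    rw [← sub_eq_zero]
    funext ⟨i, v⟩
    refine congrFun (eq_zero_of_evalDFT_eq_zero hζ
      (fun i => (shiftQC F m l ^ n) c (i, v) - c (i, v)) fun j => ?_) i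
    rw [evalDFT_sub, evalDFT_shiftQC_pow hζ]
    by_cases hne : evalDFT ζ (fun i => c (i, v)) j = 0
    · simp [hne]
    · simp [(key j).2 (h j v hne)]

theorem shiftQC_pow_card [NeZero m] {ζ : E} (hζ : IsPrimitiveRoot ζ m) :
    shiftQC F m l ^ m = 1 := by
  ext1 c
  exact (shiftQC_pow_apply_eq_iff hζ m c).2 fun j _ _ => by simp

theorem natCast_mul_eq_zero_of_mem_cycCoset {q i : ℕ} (hco : Nat.Coprime m q) {j : ZMod m}
    (hj : j ∈ cycCoset q m i) (n : ℕ) : (n : ZMod m) * j = 0 ↔ m ∣ n * i := by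
  obtain ⟨r, rfl⟩ := hj
  have hu : IsUnit ((q : ZMod m) ^ r) := ((ZMod.isUnit_iff_coprime q m).2 hco.symm).pow r
  rw [← mul_assoc, hu.mul_left_eq_zero, ← ZMod.natCast_eq_zero_iff]
  simp

/-- The period of a nonzero word over a minimal ideal. -/
theorem shiftQC_pow_apply_eq_iff_dvd [NeZero m] {ζ : E} (hζ : IsPrimitiveRoot ζ m) {q i : ℕ}
    (hco : Nat.Coprime m q) {c : (ZMod m × Fin l) → F} (hc0 : c ≠ 0)
    (hc : ∀ v : Fin l, inMinIdeal q ζ i (fun k : ZMod m => c (k, v))) (n : ℕ) :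
    (shiftQC F m l ^ n) c = c ↔ m ∣ n * i := by
  have hmem : ∀ j v, evalDFT ζ (fun k => c (k, v)) j ≠ 0 → j ∈ cycCoset q m i :=
    fun j v hne => by_contra fun hj => hne (hc v j hj)
  rw [shiftQC_pow_apply_eq_iff hζ]
  constructor
  · intro h
    obtain ⟨j, v, hne⟩ : ∃ j v, evalDFT ζ (fun k => c (k, v)) j ≠ 0 := by
      by_contra! hall
      refine hc0 (funext fun ⟨k, v⟩ => ?_)
      exact congrFun (eq_zero_of_evalDFT_eq_zero hζ (fun k => c (k, v)) fun j => hall j v) k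
    exact (natCast_mul_eq_zero_of_mem_cycCoset hco (hmem j v hne) n).1 (h j v hne)
  · intro h j v hne
    exact (natCast_mul_eq_zero_of_mem_cycCoset hco (hmem j v hne) n).2 h

theorem cycCoset_eq_of_mem [NeZero m] {q i : ℕ} (hco : Nat.Coprime m q) {j : ZMod m}
    (hj : j ∈ cycCoset q m i) : cycCoset q m i = {k | ∃ r : ℕ, k = j * (q : ZMod m) ^ r} := by
  obtain ⟨s, rfl⟩ := hj
  obtain ⟨u, hu⟩ := (ZMod.isUnit_iff_coprime q m).2 hco.symm
  have hpos : 0 < orderOf u := orderOf_pos u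
  have hone : (q : ZMod m) ^ orderOf u = 1 := by
    rw [← hu, ← Units.val_pow_eq_pow_val, pow_orderOf_eq_one, Units.val_one]
  ext k
  constructor
  · rintro ⟨r, rfl⟩
    refine ⟨r + (orderOf u * s - s), ?_⟩
    have hle : s ≤ orderOf u * s := Nat.le_mul_of_pos_left s hpos
    rw [mul_assoc, ← pow_add, show s + (r + (orderOf u * s - s)) = r + orderOf u * s by omega,
      pow_add, pow_mul, hone, one_pow, mul_one]
  · rintro ⟨r, rfl⟩
    exact ⟨s + r, by rw [pow_add, mul_assoc]⟩

/-- Words over two distinct minimal ideals are equal only if they vanish. -/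
theorem eq_zero_of_inMinIdeal_of_inMinIdeal [NeZero m] {ζ : E} (hζ : IsPrimitiveRoot ζ m)
    {q i₁ i₂ : ℕ} (hco : Nat.Coprime m q) (hdist : cycCoset q m i₁ ≠ cycCoset q m i₂)
    {c : (ZMod m × Fin l) → F}
    (h₁ : ∀ v : Fin l, inMinIdeal q ζ i₁ (fun k : ZMod m => c (k, v)))
    (h₂ : ∀ v : Fin l, inMinIdeal q ζ i₂ (fun k : ZMod m => c (k, v))) : c = 0 := by
  funext ⟨k, v⟩
  refine congrFun (eq_zero_of_evalDFT_eq_zero hζ (fun k => c (k, v)) fun j => ?_) k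
  by_cases hj₁ : j ∈ cycCoset q m i₁
  · by_cases hj₂ : j ∈ cycCoset q m i₂
    · exact absurd ((cycCoset_eq_of_mem hco hj₁).trans (cycCoset_eq_of_mem hco hj₂).symm) hdist
    · exact h₂ v j hj₂
  · exact h₁ v j hj₁

end Orbits

/-- The number of orbits on a finite invariant set is the sum of the reciprocals of the orbit
lengths. -/
theorem ncard_image_orbit_eq_sum {G X : Type*} [Group G] [MulAction G X] (S : Finset X)
    (hS : ∀ x ∈ S, MulAction.orbit G x ⊆ S) :
    ((MulAction.orbit G '' (S : Set X)).ncard : ℚ) =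
      ∑ x ∈ S, ((MulAction.orbit G x).ncard : ℚ)⁻¹ := by
  classical
  rw [← Finset.coe_image, Set.ncard_coe_finset, Finset.card_eq_sum_ones, Nat.cast_sum]
  refine Finset.sum_image' _ fun x hx => ?_
  have hfib : ((S.filter fun y => MulAction.orbit G y = MulAction.orbit G x : Finset X) : Set X)
      = MulAction.orbit G x := by
    ext y
    simp only [Finset.coe_filter, Set.mem_ofPred_eq, MulAction.orbit_eq_iff]
    exact ⟨fun h => h.2, fun h => ⟨hS x hx h, h⟩⟩
  rw [Finset.sum_congr rfl fun y hy => by rw [(Finset.mem_filter.1 hy).2], Finset.sum_const,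
    ← Set.ncard_coe_finset, hfib, nsmul_eq_mul, Nat.cast_one, mul_inv_cancel₀]
  rw [Nat.cast_ne_zero]
  exact ((Set.ncard_pos (S.finite_toSet.subset (hS x hx))).2 (MulAction.nonempty_orbit x)).ne'

/-- If `g ^ n` fixes `x` exactly when `m ∣ n * a`, then the orbit of `x` under `g` has
`m / gcd m a` elements. -/
theorem inv_ncard_orbit_zpowers {G X : Type*} [Group G] [MulAction G X] {m : ℕ} [NeZero m]
    (g : G) (x : X) (a : ℕ) (h : ∀ n : ℕ, g ^ n • x = x ↔ m ∣ n * a) :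
    ((MulAction.orbit (Subgroup.zpowers g) x).ncard : ℚ)⁻¹ = (Nat.gcd m a : ℚ) / m := by
  have hm : 0 < m := NeZero.pos m
  have hd : 0 < m.gcd a := Nat.gcd_pos_of_pos_left a hm
  have hdvd (n : ℕ) : m ∣ n * a ↔ m / m.gcd a ∣ n := by
    constructor
    · intro hn
      refine (Nat.coprime_div_gcd_div_gcd hd).dvd_of_dvd_mul_right ?_
      rw [← Nat.mul_div_assoc _ (Nat.gcd_dvd_right m a)]
      exact Nat.div_dvd_div (Nat.gcd_dvd_left m a) hn
    · intro hn
      calc m = m / m.gcd a * m.gcd a := (Nat.div_mul_cancel (Nat.gcd_dvd_left m a)).symm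
        _ ∣ n * a := mul_dvd_mul hn (Nat.gcd_dvd_right m a)
  have hper : Function.minimalPeriod (g • ·) x = m / m.gcd a := by
    refine Nat.dvd_right_iff_eq.1 fun n => ?_
    rw [← Function.isPeriodicPt_iff_minimalPeriod_dvd, ← hdvd, ← h, Function.IsPeriodicPt,
      Function.IsFixedPt, smul_iterate]
  have hcard : (MulAction.orbit (Subgroup.zpowers g) x).ncard = m / m.gcd a := by
    rw [← hper, ← Nat.card_coe_set_eq,
      Nat.card_congr (MulAction.orbitZPowersEquiv g x), Nat.card_zmod]
  rw [hcard, Nat.cast_div (Nat.gcd_dvd_left m a) (by positivity), inv_div]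

theorem Fintype.sum_ite_eq_zero {M : Type*} [Fintype M] [Zero M] [DecidableEq M] (x y : ℚ) :
    ∑ a : M, (if a = 0 then x else y) = x + ((Fintype.card M - 1 : ℕ) : ℚ) * y := by
  rw [← Finset.add_sum_erase _ _ (Finset.mem_univ (0 : M)), if_pos rfl,
    Finset.sum_congr rfl fun a ha => if_neg (Finset.ne_of_mem_erase ha), Finset.sum_const,
    Finset.card_erase_of_mem (Finset.mem_univ _), Finset.card_univ, nsmul_eq_mul]

theorem Submodule.pow_apply_mem {R V : Type*} [Semiring R] [AddCommMonoid V] [Module R V]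
    {σ : V ≃ₗ[R] V} {C : Submodule R V} (hC : ∀ c ∈ C, σ c ∈ C) (n : ℕ) {c : V} (hc : c ∈ C) :
    (σ ^ n) c ∈ C := by
  induction n with
  | zero => simpa using hc
  | succ n ih =>
    rw [pow_succ']
    exact hC _ ih

/-- Let `C = C_{t₁} ⊕ C_{t₂}` be a quasi-cyclic code of length `lm` and
index `l` over `F_q`, each `C_{t_j}` an `[lm, K_{t_j}]` linear code over the minimal ideal
`R_m ε_{t_j}` (distinct cyclotomic cosets).  Then the number of orbits of `⟨ρ^l⟩` on
`C \ {0}` equals `gcd(m,i_{t₁},i_{t₂})(q^{K_{t₁}}-1)(q^{K_{t₂}}-1)/m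
+ gcd(m,i_{t₁})(q^{K_{t₁}}-1)/m + gcd(m,i_{t₂})(q^{K_{t₂}}-1)/m`. -/
theorem orbits_shift_two_components {F E : Type*} [Field F] [Fintype F] [DecidableEq F]
    [Field E] [Algebra F E] {m l K₁ K₂ i₁ i₂ : ℕ} [NeZero m] (hl : 2 ≤ l)
    (hco : Nat.Coprime m (Fintype.card F))
    (ζ : E) (hζ : IsPrimitiveRoot ζ m)
    (C₁ C₂ : Submodule F ((ZMod m × Fin l) → F))
    (hQC₁ : ∀ c ∈ C₁, shiftQC F m l c ∈ C₁) (hQC₂ : ∀ c ∈ C₂, shiftQC F m l c ∈ C₂)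
    (hmin₁ : ∀ c ∈ C₁, ∀ v : Fin l,
      inMinIdeal (Fintype.card F) ζ i₁ (fun i : ZMod m => c (i, v)))
    (hmin₂ : ∀ c ∈ C₂, ∀ v : Fin l,
      inMinIdeal (Fintype.card F) ζ i₂ (fun i : ZMod m => c (i, v)))
    (hK₁ : Module.finrank F ↥C₁ = K₁) (hK₂ : Module.finrank F ↥C₂ = K₂)
    (hdist : cycCoset (Fintype.card F) m i₁ ≠ cycCoset (Fintype.card F) m i₂)
    (C : Set ((ZMod m × Fin l) → F))
    (hCsum : C = {c | ∃ c₁ ∈ C₁, ∃ c₂ ∈ C₂, c = c₁ + c₂}) :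
    (Set.ncard {O : Set ((ZMod m × Fin l) → F) | ∃ c, c ∈ C ∧ c ≠ 0 ∧
        O = {x | ∃ z : ℤ, (shiftQC F m l ^ z) c = x}} : ℚ) =
      (Nat.gcd m (Nat.gcd i₁ i₂) *
          ((Fintype.card F ^ K₁ - 1) * (Fintype.card F ^ K₂ - 1)) : ℕ) / (m : ℚ) +
      (Nat.gcd m i₁ * (Fintype.card F ^ K₁ - 1) : ℕ) / (m : ℚ) +
      (Nat.gcd m i₂ * (Fintype.card F ^ K₂ - 1) : ℕ) / (m : ℚ) := by
  classical
  set σ := shiftQC F m l with hσ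
  set q := Fintype.card F with hq
  let f : (C₁ × C₂) →ₗ[F] ((ZMod m × Fin l) → F) := C₁.subtype.coprod C₂.subtype
  have hf (p : C₁ × C₂) : f p = p.1.1 + p.2.1 := by simp [f]
  have hzero {x : (ZMod m × Fin l) → F} (h₁ : x ∈ C₁) (h₂ : x ∈ C₂) : x = 0 :=
    eq_zero_of_inMinIdeal_of_inMinIdeal hζ hco hdist (hmin₁ x h₁) (hmin₂ x h₂)
  have hinj : Function.Injective f := by
    rw [injective_iff_map_eq_zero]
    rintro ⟨⟨a, ha⟩, ⟨b, hb⟩⟩ h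
    have hab : a + b = 0 := by simpa [hf] using h
    have ha0 : a = 0 := hzero ha (by rw [eq_neg_of_add_eq_zero_left hab]; exact C₂.neg_mem hb)
    have hb0 : b = 0 := by simpa [ha0] using hab
    subst ha0 hb0
    rfl
  have hpow (n : ℕ) (p : C₁ × C₂) : (σ ^ n) (f p) =
      f (⟨_, Submodule.pow_apply_mem hQC₁ n p.1.2⟩, ⟨_, Submodule.pow_apply_mem hQC₂ n p.2.2⟩) := by
    simp [hf]
  have hfix (n : ℕ) (p : C₁ × C₂) : (σ ^ n) (f p) = f p ↔
      (σ ^ n) p.1.1 = p.1.1 ∧ (σ ^ n) p.2.1 = p.2.1 := by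
    rw [hpow, hinj.eq_iff, Prod.ext_iff, Subtype.ext_iff, Subtype.ext_iff]
  have hper₁ (n : ℕ) (a : C₁) (ha : a ≠ 0) : (σ ^ n) a.1 = a.1 ↔ m ∣ n * i₁ :=
    shiftQC_pow_apply_eq_iff_dvd hζ hco (by simpa using ha) (hmin₁ a.1 a.2) n
  have hper₂ (n : ℕ) (b : C₂) (hb : b ≠ 0) : (σ ^ n) b.1 = b.1 ↔ m ∣ n * i₂ :=
    shiftQC_pow_apply_eq_iff_dvd hζ hco (by simpa using hb) (hmin₂ b.1 b.2) n
  let T : Finset (C₁ × C₂) := Finset.univ.filter (· ≠ 0)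
  have hfin : IsOfFinOrder σ :=
    isOfFinOrder_iff_pow_eq_one.2 ⟨m, NeZero.pos m, shiftQC_pow_card hζ⟩
  have hT : ∀ x ∈ T.image f, MulAction.orbit (Subgroup.zpowers σ) x ⊆ (T.image f : Finset _) := by
    intro x hx
    obtain ⟨p, hp, rfl⟩ := Finset.mem_image.1 hx
    rintro _ ⟨⟨g, hg⟩, rfl⟩
    obtain ⟨n, rfl⟩ := hfin.mem_powers_iff_mem_zpowers.2 hg
    refine Finset.mem_coe.2 (Finset.mem_image.2 ⟨_, ?_, (hpow n p).symm⟩)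
    simp only [T, Finset.mem_filter, Finset.mem_univ, true_and] at hp ⊢
    intro h
    apply hp
    have h0 : (σ ^ n) (f p) = 0 := by rw [hpow, h, map_zero]
    exact hinj (by rw [map_zero]; exact (LinearEquiv.map_eq_zero_iff _).1 h0)
  have horb : {O : Set ((ZMod m × Fin l) → F) | ∃ c, c ∈ C ∧ c ≠ 0 ∧
      O = {x | ∃ z : ℤ, (σ ^ z) c = x}} =
      MulAction.orbit (Subgroup.zpowers σ) '' ((T.image f : Finset _) : Set _) := by
    have horb' (c : (ZMod m × Fin l) → F) :
        MulAction.orbit (Subgroup.zpowers σ) c = {x | ∃ z : ℤ, (σ ^ z) c = x} := by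
      ext x
      simp [MulAction.mem_orbit_iff, Subgroup.smul_def]
    ext O
    constructor
    · rintro ⟨c, hc, hc0, rfl⟩
      rw [hCsum] at hc
      obtain ⟨a, ha, b, hb, rfl⟩ := hc
      refine ⟨a + b, ?_, horb' _⟩
      refine Finset.mem_coe.2 (Finset.mem_image.2 ⟨(⟨a, ha⟩, ⟨b, hb⟩), ?_, hf _⟩)
      simp only [T, Finset.mem_filter, Finset.mem_univ, true_and]
      intro h
      exact hc0 (by rw [← hf (⟨a, ha⟩, ⟨b, hb⟩), h, map_zero])
    · rintro ⟨c, hc, rfl⟩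
      obtain ⟨p, hp, rfl⟩ := Finset.mem_image.1 (Finset.mem_coe.1 hc)
      refine ⟨f p, ?_, ?_, horb' _⟩
      · rw [hCsum]
        exact ⟨_, p.1.2, _, p.2.2, hf p⟩
      · rw [Ne, map_eq_zero_iff f hinj]
        simpa [T] using hp
  have hsum : ∑ p ∈ T, ((MulAction.orbit (Subgroup.zpowers σ) (f p)).ncard : ℚ)⁻¹ =
      ∑ p : C₁ × C₂, if p.1 = 0 then (if p.2 = 0 then 0 else (m.gcd i₂ : ℚ) / m)
        else (if p.2 = 0 then (m.gcd i₁ : ℚ) / m else (m.gcd (i₁.gcd i₂) : ℚ) / m) := by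
    rw [Finset.sum_filter]
    refine Finset.sum_congr rfl fun ⟨a, b⟩ _ => ?_
    by_cases ha : a = 0 <;> by_cases hb : b = 0
    · simp [ha, hb]
    · rw [if_pos (by simp [hb]), if_pos ha, if_neg hb]
      refine inv_ncard_orbit_zpowers σ _ _ fun n => ?_
      rw [LinearEquiv.smul_def, hfix, hper₂ n b hb]
      simp [ha]
    · rw [if_pos (by simp [ha]), if_neg ha, if_pos hb]
      refine inv_ncard_orbit_zpowers σ _ _ fun n => ?_
      rw [LinearEquiv.smul_def, hfix, hper₁ n a ha]
      simp [hb]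
    · rw [if_pos (by simp [ha]), if_neg ha, if_neg hb]
      refine inv_ncard_orbit_zpowers σ _ _ fun n => ?_
      rw [LinearEquiv.smul_def, hfix, hper₁ n a ha, hper₂ n b hb, ← Nat.dvd_gcd_iff,
        Nat.gcd_mul_left]
  have hcard₁ : Fintype.card C₁ = q ^ K₁ := by rw [Module.card_eq_pow_finrank (K := F), hK₁]
  have hcard₂ : Fintype.card C₂ = q ^ K₂ := by rw [Module.card_eq_pow_finrank (K := F), hK₂]
  rw [horb, ncard_image_orbit_eq_sum _ hT, Finset.sum_image hinj.injOn, hsum,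
    Fintype.sum_prod_type]
  have hinner (a : C₁) : (∑ b : C₂, if a = 0 then (if b = 0 then 0 else (m.gcd i₂ : ℚ) / m)
      else (if b = 0 then (m.gcd i₁ : ℚ) / m else (m.gcd (i₁.gcd i₂) : ℚ) / m)) =
      if a = 0 then 0 + ((q ^ K₂ - 1 : ℕ) : ℚ) * ((m.gcd i₂ : ℚ) / m)
      else (m.gcd i₁ : ℚ) / m + ((q ^ K₂ - 1 : ℕ) : ℚ) * ((m.gcd (i₁.gcd i₂) : ℚ) / m) := by
    split_ifs <;> rw [Fintype.sum_ite_eq_zero, hcard₂]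
  simp only [hinner]
  rw [Fintype.sum_ite_eq_zero, hcard₁]
  simp only [Nat.cast_mul]
  ring
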